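/- arXiv:1302.3308 — 5 statements merged into one kernel-verified Lean document; each statement's English description precedes it below -/
import Mathlib

section
/- Let Y_1, Y_2 ⊆ Y and Z_1, Z_2 ⊆ Z be subsets with Y_1 ∩ Y_2 = ∅ and Z_1 ∩ Z_2 = ∅. If f ∈ F[Y_1 ∪ Z_1] and g ∈ F[Y_2 ∪ Z_2], then maxrank(M_{fg}) = maxrank(M_f) · maxrank(M_g). -/
open scoped Classical

noncomputable section

namespace PCM

variable {F : Type} [Field F] {Y Z : Type} [Fintype Y] [Fintype Z]

/-- Exponent vector of the monic multilinear monomial `∏_{y ∈ p} y · ∏_{z ∈ q} z`. -/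
def mexp (p : Finset Y) (q : Finset Z) : (Y ⊕ Z) →₀ ℕ :=
  (∑ y ∈ p, Finsupp.single (Sum.inl y) 1) + ∑ z ∈ q, Finsupp.single (Sum.inr z) 1

/-- The polynomial coefficient matrix `M_f`. -/
def coeffMatrix (f : MvPolynomial (Y ⊕ Z) F) :
    Matrix (Finset Y) (Finset Z) (MvPolynomial (Y ⊕ Z) F) := fun p q =>
  ∑ d ∈ f.support,
    if d.support ⊆ p.image Sum.inl ∪ q.image Sum.inr ∧ mexp p q ≤ d then
      MvPolynomial.monomial (d - mexp p q) (MvPolynomial.coeff d f)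
    else 0

/-- `maxrank(M_f)`: the maximum, over substitutions `S`, of the rank of `M_f|_S`. -/
def maxrank (f : MvPolynomial (Y ⊕ Z) F) : ℕ :=
  ⨆ S : (Y ⊕ Z) → F, ((coeffMatrix f).map (MvPolynomial.eval S)).rank

/-- The partial derivatives matrix `L_f`. -/
def pdMatrix (f : MvPolynomial (Y ⊕ Z) F) : Matrix (Finset Y) (Finset Z) F := fun p q =>
  MvPolynomial.coeff (mexp p q) f

end PCM

open scoped Kronecker

/-- The rank of a tensor product of linear maps is the product of the ranks. -/
theorem LinearMap.finrank_range_tensorMap {K V W V' W' : Type*} [Field K] [AddCommGroup V]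
    [AddCommGroup W] [AddCommGroup V'] [AddCommGroup W'] [Module K V] [Module K W] [Module K V']
    [Module K W'] (f : V →ₗ[K] V') (g : W →ₗ[K] W') :
    Module.finrank K (LinearMap.range (TensorProduct.map f g)) =
      Module.finrank K (LinearMap.range f) * Module.finrank K (LinearMap.range g) := by
  have h : LinearMap.range (TensorProduct.map f g) =
      LinearMap.range (TensorProduct.mapIncl (LinearMap.range f) (LinearMap.range g)) := by
    rw [TensorProduct.mapIncl, TensorProduct.range_map, TensorProduct.range_map,
      Submodule.range_subtype, Submodule.range_subtype]
  rw [h, ← Module.finrank_tensorProduct (R := K) (S := K)]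
  exact LinearMap.finrank_range_of_inj
    (TensorProduct.map_injective_of_flat_flat _ _
      (Submodule.subtype_injective _) (Submodule.subtype_injective _))

namespace Matrix

/-- The rank of a Kronecker product is the product of the ranks. -/
theorem rank_kronecker_eq {K l m n o : Type*} [Field K] [Fintype l] [Fintype m] [Fintype n]
    [Fintype o] (A : Matrix l m K) (B : Matrix n o K) :
    (A ⊗ₖ B).rank = A.rank * B.rank := by
  rw [rank_eq_finrank_range_toLin (A ⊗ₖ B)
      ((Pi.basisFun K l).tensorProduct (Pi.basisFun K n))
      ((Pi.basisFun K m).tensorProduct (Pi.basisFun K o)),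
    Matrix.toLin_kronecker,
    rank_eq_finrank_range_toLin A (Pi.basisFun K l) (Pi.basisFun K m),
    rank_eq_finrank_range_toLin B (Pi.basisFun K n) (Pi.basisFun K o),
    LinearMap.finrank_range_tensorMap]

/-- Deleting zero rows and zero columns does not change the rank. -/
theorem rank_submatrix_of_support {K m n m₀ n₀ : Type*} [Field K] [Fintype m] [Fintype n]
    [Fintype m₀] [Fintype n₀] (M : Matrix m n K) {r : m₀ → m} {c : n₀ → n}
    (hr : Function.Injective r) (hc : Function.Injective c)
    (hM : ∀ i j, M i j ≠ 0 → i ∈ Set.range r ∧ j ∈ Set.range c) :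
    (M.submatrix r c).rank = M.rank := by
  refine le_antisymm (rank_submatrix_le M r c) ?_
  have h : M = (Matrix.of fun i a => if i = r a then (1 : K) else 0) * M.submatrix r c *
      (Matrix.of fun b j => if j = c b then (1 : K) else 0) := by
    ext i j
    simp only [mul_apply, of_apply, submatrix_apply, ite_mul, mul_ite, one_mul, zero_mul,
      mul_one, mul_zero]
    by_cases hij : M i j = 0
    · rw [hij]
      refine (Finset.sum_eq_zero fun b _ => ?_).symm
      split_ifs with hj
      · refine Finset.sum_eq_zero fun a _ => ?_
        split_ifs with hi
        · rw [← hi, ← hj, hij]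
        · rfl
      · rfl
    · obtain ⟨⟨a, rfl⟩, ⟨b, rfl⟩⟩ := hM i j hij
      simp [hr.eq_iff, hc.eq_iff]
  conv_lhs => rw [h]
  exact (rank_mul_le_left _ _).trans (rank_mul_le_right _ _)

end Matrix

namespace PCM

section Mexp

variable {Y Z : Type}

theorem mexp_inl (p : Finset Y) (q : Finset Z) (y : Y) :
    mexp p q (Sum.inl y) = if y ∈ p then 1 else 0 := by
  simp [mexp, Finsupp.single_apply]

theorem mexp_inr (p : Finset Y) (q : Finset Z) (z : Z) :
    mexp p q (Sum.inr z) = if z ∈ q then 1 else 0 := by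
  simp [mexp, Finsupp.single_apply]

theorem support_subset_and_mexp_le_iff (p : Finset Y) (q : Finset Z) (d : (Y ⊕ Z) →₀ ℕ) :
    (d.support ⊆ p.image Sum.inl ∪ q.image Sum.inr ∧ mexp p q ≤ d) ↔
      d.support = p.image Sum.inl ∪ q.image Sum.inr := by
  rw [Finset.Subset.antisymm_iff]
  refine and_congr_right fun _ => ?_
  rw [Finsupp.le_def]
  constructor
  · rintro h (y | z) hi <;> rw [Finsupp.mem_support_iff]
    · have := h (Sum.inl y)
      rw [mexp_inl, if_pos (by simpa using hi)] at this
      omega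
    · have := h (Sum.inr z)
      rw [mexp_inr, if_pos (by simpa using hi)] at this
      omega
  · rintro h (y | z)
    · rw [mexp_inl]
      split_ifs with hy
      · exact Nat.one_le_iff_ne_zero.2 (Finsupp.mem_support_iff.1 (h (by simpa using hy)))
      · exact Nat.zero_le _
    · rw [mexp_inr]
      split_ifs with hz
      · exact Nat.one_le_iff_ne_zero.2 (Finsupp.mem_support_iff.1 (h (by simpa using hz)))
      · exact Nat.zero_le _

end Mexp

section SupportPart

variable {K σ : Type*} [Field K]

theorem support_subset_vars {f : MvPolynomial σ K} {d : σ →₀ ℕ} (hd : d ∈ f.support) :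
    d.support ⊆ f.vars := fun _ hi => (MvPolynomial.mem_vars_iff_mem_support _).2 ⟨d, hd, hi⟩

variable [Fintype σ]

/-- The part of a polynomial supported on monomials whose set of variables is exactly `s`,
divided by the product of the variables in `s` and evaluated at `S`. -/
def supportPart (S : σ → K) (s : Finset σ) : MvPolynomial σ K →ₗ[K] K :=
  (MvPolynomial.basisMonomials σ K).constr K fun d =>
    if d.support = s then ∏ i, S i ^ (d i - 1) else 0

theorem supportPart_monomial (S : σ → K) (s : Finset σ) (d : σ →₀ ℕ) (a : K) :
    supportPart S s (MvPolynomial.monomial d a) =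
      if d.support = s then a * ∏ i, S i ^ (d i - 1) else 0 := by
  have h : MvPolynomial.monomial d a = a • MvPolynomial.basisMonomials σ K d := by
    simp [MvPolynomial.smul_monomial]
  rw [h, map_smul, supportPart, Module.Basis.constr_basis]
  simp

theorem supportPart_apply (S : σ → K) (s : Finset σ) (f : MvPolynomial σ K) :
    supportPart S s f = ∑ d ∈ f.support,
      if d.support = s then f.coeff d * ∏ i, S i ^ (d i - 1) else 0 := by
  conv_lhs => rw [f.as_sum, map_sum]
  simp only [supportPart_monomial]

theorem subset_vars_of_supportPart_ne_zero {S : σ → K} {s : Finset σ} {f : MvPolynomial σ K}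
    (h : supportPart S s f ≠ 0) : s ⊆ f.vars := by
  rw [supportPart_apply] at h
  obtain ⟨d, hd, hne⟩ := Finset.exists_ne_zero_of_sum_ne_zero h
  split_ifs at hne with hs
  · exact hs ▸ support_subset_vars hd
  · exact absurd rfl hne

theorem supportPart_congr {S S' : σ → K} {f : MvPolynomial σ K}
    (h : ∀ i ∈ f.vars, S i = S' i) (s : Finset σ) :
    supportPart S s f = supportPart S' s f := by
  simp only [supportPart_apply]
  refine Finset.sum_congr rfl fun d hd => ?_
  congr 2
  refine Finset.prod_congr rfl fun i _ => ?_
  by_cases hi : i ∈ d.support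
  · rw [h i (support_subset_vars hd hi)]
  · simp [Finsupp.notMem_support_iff.1 hi]

theorem supportPart_mul {f g : MvPolynomial σ K} {T : Finset σ} (hf : f.vars ⊆ T)
    (hg : Disjoint g.vars T) (S : σ → K) (s : Finset σ) :
    supportPart S s (f * g) = supportPart S (s ∩ T) f * supportPart S (s \ T) g := by
  rw [supportPart_apply S _ f, supportPart_apply S _ g]
  conv_lhs => rw [f.as_sum, g.as_sum]
  simp only [Finset.sum_mul_sum, map_sum, MvPolynomial.monomial_mul, supportPart_monomial]
  refine Finset.sum_congr rfl fun d hd => Finset.sum_congr rfl fun e he => ?_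
  have hdT : d.support ⊆ T := (support_subset_vars hd).trans hf
  have heT : Disjoint e.support T := hg.mono_left (support_subset_vars he)
  have hde : Disjoint d.support e.support := (heT.mono_right hdT).symm
  have hs : (d + e).support = s ↔ d.support = s ∩ T ∧ e.support = s \ T := by
    rw [Finsupp.support_add_eq hde]
    constructor
    · rintro rfl
      constructor
      · rw [Finset.union_inter_distrib_right, Finset.inter_eq_left.2 hdT,
          Finset.disjoint_iff_inter_eq_empty.1 heT, Finset.union_empty]
      · rw [Finset.union_sdiff_distrib, Finset.sdiff_eq_empty_iff_subset.2 hdT,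
          Finset.sdiff_eq_self_of_disjoint heT, Finset.empty_union]
    · rintro ⟨h₁, h₂⟩
      rw [h₁, h₂, Finset.union_comm, Finset.sdiff_union_inter]
  have hw : ∏ i, S i ^ ((d + e) i - 1) =
      (∏ i, S i ^ (d i - 1)) * ∏ i, S i ^ (e i - 1) := by
    rw [← Finset.prod_mul_distrib]
    refine Finset.prod_congr rfl fun i _ => ?_
    by_cases hi : i ∈ d.support
    · have := Finsupp.notMem_support_iff.1 (Finset.disjoint_left.1 hde hi)
      simp [this]
    · simp [Finsupp.notMem_support_iff.1 hi]
  by_cases h₁ : d.support = s ∩ T <;> by_cases h₂ : e.support = s \ T <;>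
    simp only [hs, h₁, h₂, hw, and_self, and_true, and_false, if_true, if_false, mul_zero,
      zero_mul]
  ring

end SupportPart

variable {F : Type} [Field F] {Y Z : Type} [Fintype Z]

theorem bddAbove_rank_coeffMatrix (f : MvPolynomial (Y ⊕ Z) F) :
    BddAbove (Set.range fun S : Y ⊕ Z → F =>
      ((coeffMatrix f).map (MvPolynomial.eval S)).rank) :=
  ⟨Fintype.card (Finset Z), by rintro _ ⟨S, rfl⟩; exact Matrix.rank_le_card_width _⟩

theorem rank_le_maxrank (f : MvPolynomial (Y ⊕ Z) F) (S : Y ⊕ Z → F) :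
    ((coeffMatrix f).map (MvPolynomial.eval S)).rank ≤ maxrank f :=
  le_ciSup (bddAbove_rank_coeffMatrix f) S

theorem exists_rank_eq_maxrank (f : MvPolynomial (Y ⊕ Z) F) :
    ∃ S : Y ⊕ Z → F, ((coeffMatrix f).map (MvPolynomial.eval S)).rank = maxrank f :=
  Nat.sSup_mem (Set.range_nonempty _) (bddAbove_rank_coeffMatrix f)

variable [Fintype Y]

theorem eval_coeffMatrix (f : MvPolynomial (Y ⊕ Z) F) (S : Y ⊕ Z → F) (p : Finset Y)
    (q : Finset Z) :
    MvPolynomial.eval S (coeffMatrix f p q) =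
      supportPart S (p.image Sum.inl ∪ q.image Sum.inr) f := by
  rw [coeffMatrix, map_sum, supportPart_apply]
  refine Finset.sum_congr rfl fun d _ => ?_
  simp only [support_subset_and_mexp_le_iff]
  split_ifs with h
  · rw [MvPolynomial.eval_monomial, Finsupp.prod_fintype _ _ fun i => pow_zero _]
    congr 1
    refine Finset.prod_congr rfl fun i _ => ?_
    congr 1
    have hi : i ∈ d.support ↔ i ∈ p.image Sum.inl ∪ q.image Sum.inr := by rw [h]
    rw [Finsupp.mem_support_iff] at hi
    rcases i with y | z
    · rw [Finsupp.tsub_apply, mexp_inl]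
      split_ifs with hy
      · rfl
      · have : d (Sum.inl y) = 0 := by simpa [hy] using hi
        omega
    · rw [Finsupp.tsub_apply, mexp_inr]
      split_ifs with hz
      · rfl
      · have : d (Sum.inr z) = 0 := by simpa [hz] using hi
        omega
  · exact map_zero _

theorem map_eval_coeffMatrix_congr {f : MvPolynomial (Y ⊕ Z) F} {S S' : Y ⊕ Z → F}
    (h : ∀ i ∈ f.vars, S i = S' i) :
    (coeffMatrix f).map (MvPolynomial.eval S) = (coeffMatrix f).map (MvPolynomial.eval S') := by
  ext p q
  simp only [Matrix.map_apply, eval_coeffMatrix, supportPart_congr h]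

theorem split_injective {α : Type*} (T : Finset α) :
    Function.Injective fun p : Finset α => (p ∩ T, p \ T) := by
  intro p p' h
  obtain ⟨h₁, h₂⟩ := Prod.mk.inj h
  rw [← Finset.sdiff_union_inter p T, ← Finset.sdiff_union_inter p' T, h₁, h₂]

theorem mem_range_split {α : Type*} {T a b : Finset α} (ha : a ⊆ T) (hb : Disjoint b T) :
    (a, b) ∈ Set.range fun p : Finset α => (p ∩ T, p \ T) := by
  refine ⟨a ∪ b, Prod.ext ?_ ?_⟩
  · change (a ∪ b) ∩ T = a
    rw [Finset.union_inter_distrib_right, Finset.inter_eq_left.2 ha,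
      Finset.disjoint_iff_inter_eq_empty.1 hb, Finset.union_empty]
  · change (a ∪ b) \ T = b
    rw [Finset.union_sdiff_distrib, Finset.sdiff_eq_empty_iff_subset.2 ha,
      Finset.sdiff_eq_self_of_disjoint hb, Finset.empty_union]

theorem rank_coeffMatrix_mul {f g : MvPolynomial (Y ⊕ Z) F} {U : Finset Y} {V : Finset Z}
    (hf : f.vars ⊆ U.image Sum.inl ∪ V.image Sum.inr)
    (hg : Disjoint g.vars (U.image Sum.inl ∪ V.image Sum.inr)) (S : Y ⊕ Z → F) :
    ((coeffMatrix (f * g)).map (MvPolynomial.eval S)).rank =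
      ((coeffMatrix f).map (MvPolynomial.eval S)).rank *
        ((coeffMatrix g).map (MvPolynomial.eval S)).rank := by
  rw [← Matrix.rank_kronecker_eq,
    ← Matrix.rank_submatrix_of_support _ (split_injective U) (split_injective V)]
  · congr 1
    ext p q
    simp only [Matrix.map_apply, Matrix.submatrix_apply, Matrix.kronecker_apply,
      eval_coeffMatrix]
    rw [supportPart_mul hf hg]
    congr 3 <;> ext (y | z) <;> simp
  · rintro ⟨p, p'⟩ ⟨q, q'⟩ h
    simp only [Matrix.kronecker_apply, Matrix.map_apply, eval_coeffMatrix] at h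
    have h₁ := (subset_vars_of_supportPart_ne_zero (left_ne_zero_of_mul h)).trans hf
    have h₂ := hg.mono_left (subset_vars_of_supportPart_ne_zero (right_ne_zero_of_mul h))
    constructor
    · refine mem_range_split (fun y hy => ?_) (Finset.disjoint_left.2 fun y hy hU => ?_)
      · simpa using h₁ (Finset.mem_union_left _ (Finset.mem_image_of_mem _ hy))
      · exact Finset.disjoint_left.1 h₂ (Finset.mem_union_left _ (Finset.mem_image_of_mem _ hy))
          (Finset.mem_union_left _ (Finset.mem_image_of_mem _ hU))
    · refine mem_range_split (fun z hz => ?_) (Finset.disjoint_left.2 fun z hz hV => ?_)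
      · simpa using h₁ (Finset.mem_union_right _ (Finset.mem_image_of_mem _ hz))
      · exact Finset.disjoint_left.1 h₂ (Finset.mem_union_right _ (Finset.mem_image_of_mem _ hz))
          (Finset.mem_union_right _ (Finset.mem_image_of_mem _ hV))

end PCM

/-- for `f` over variables `Y₁ ∪ Z₁` and `g` over variables `Y₂ ∪ Z₂`,
with `Y₁ ∩ Y₂ = ∅` and `Z₁ ∩ Z₂ = ∅`,
`maxrank(M_{fg}) = maxrank(M_f) · maxrank(M_g)`. -/
theorem maxrank_mul_of_disjoint {F : Type} [Field F] {Y Z : Type} [Fintype Y] [Fintype Z]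
    (Y₁ Y₂ : Finset Y) (Z₁ Z₂ : Finset Z)
    (hY : Disjoint Y₁ Y₂) (hZ : Disjoint Z₁ Z₂)
    (f g : MvPolynomial (Y ⊕ Z) F)
    (hf : f.vars ⊆ Y₁.image Sum.inl ∪ Z₁.image Sum.inr)
    (hg : g.vars ⊆ Y₂.image Sum.inl ∪ Z₂.image Sum.inr) :
    PCM.maxrank (f * g) = PCM.maxrank f * PCM.maxrank g := by
  have hT : Disjoint g.vars (Y₁.image Sum.inl ∪ Z₁.image Sum.inr) := by
    refine Finset.disjoint_left.2 fun i hi hi' => ?_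
    have := hg hi
    rcases i with y | z
    · exact Finset.disjoint_left.1 hY (by simpa using hi') (by simpa using this)
    · exact Finset.disjoint_left.1 hZ (by simpa using hi') (by simpa using this)
  apply le_antisymm
  · refine ciSup_le fun S => ?_
    rw [PCM.rank_coeffMatrix_mul hf hT]
    exact Nat.mul_le_mul (PCM.rank_le_maxrank f S) (PCM.rank_le_maxrank g S)
  · obtain ⟨S₁, h₁⟩ := PCM.exists_rank_eq_maxrank f
    obtain ⟨S₂, h₂⟩ := PCM.exists_rank_eq_maxrank g
    let S : Y ⊕ Z → F := fun i => if i ∈ f.vars then S₁ i else S₂ i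
    have hS₁ : ∀ i ∈ f.vars, S₁ i = S i := fun i hi => (if_pos hi).symm
    have hS₂ : ∀ i ∈ g.vars, S₂ i = S i := fun i hi =>
      (if_neg fun hi' => Finset.disjoint_left.1 hT hi (hf hi')).symm
    rw [← h₁, ← h₂, PCM.map_eval_coeffMatrix_congr hS₁, PCM.map_eval_coeffMatrix_congr hS₂,
      ← PCM.rank_coeffMatrix_mul hf hT]
    exact PCM.rank_le_maxrank (f * g) S
end
end

section
/- Let f ∈ F[Y ∪ Z] and let g be a polynomial all of whose variables lie in Y, or all of whose variables lie in Z (i.e., g ∈ F[Y] or g ∈ F[Z]). Then maxrank(M_{fg}) ≤ maxrank(M_f). -/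
open scoped Classical

noncomputable section

namespace PCM

/-- The exponent vector of the squarefree monomial `∏_{i ∈ s} i`. -/
def squarefreeExp {σ : Type} (s : Finset σ) : σ →₀ ℕ :=
  ∑ i ∈ s, Finsupp.single i 1

/-- The part of a polynomial consisting of the monomials whose set of variables is exactly `s`,
divided by `∏_{i ∈ s} i`. -/
def exactPart {F : Type} [Field F] {σ : Type} (s : Finset σ) :
    MvPolynomial σ F →ₗ[F] MvPolynomial σ F :=
  (MvPolynomial.basisMonomials σ F).constr F fun d =>
    if d.support = s then MvPolynomial.monomial (d - squarefreeExp s) 1 else 0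

theorem squarefreeExp_apply {σ : Type} (s : Finset σ) (i : σ) :
    squarefreeExp s i = if i ∈ s then 1 else 0 := by
  simp [squarefreeExp, Finsupp.finsetSum_apply, Finsupp.single_apply]

theorem exactPart_monomial {F : Type} [Field F] {σ : Type} (s : Finset σ) (d : σ →₀ ℕ) (c : F) :
    exactPart s (MvPolynomial.monomial d c) =
      if d.support = s then MvPolynomial.monomial (d - squarefreeExp s) c else 0 := by
  have h : MvPolynomial.monomial d c = c • MvPolynomial.basisMonomials σ F d := by
    simp [MvPolynomial.smul_monomial]
  rw [h, map_smul, exactPart, Module.Basis.constr_basis]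
  split_ifs <;> simp [MvPolynomial.smul_monomial]

theorem exactPart_mul_X {F : Type} [Field F] {σ : Type} [DecidableEq σ] (s : Finset σ) (v : σ)
    (f : MvPolynomial σ F) :
    exactPart s (f * MvPolynomial.X v) =
      if v ∈ s then MvPolynomial.X v * exactPart s f + exactPart (s.erase v) f else 0 := by
  induction f using MvPolynomial.induction_on' with
  | add f g hf hg =>
    rw [add_mul, map_add, hf, hg]
    split_ifs
    · simp only [map_add]
      ring
    · simp
  | monomial d c =>
    have hX : MvPolynomial.monomial d c * MvPolynomial.X v =
        MvPolynomial.monomial (d + Finsupp.single v 1) c := by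
      simp [MvPolynomial.X, MvPolynomial.monomial_mul]
    have hsupp : (d + Finsupp.single v 1).support = insert v d.support := by
      ext i
      by_cases hi : i = v
      · simp [hi]
      · simp [hi]
    rw [hX, exactPart_monomial, hsupp]
    split_ifs with h hv hv
    · rw [exactPart_monomial, exactPart_monomial]
      by_cases hd : v ∈ d.support
      · rw [Finset.insert_eq_self.2 hd] at h
        have hne : d.support ≠ s.erase v := fun h' => by simp [h'] at hd
        rw [if_pos h, if_neg hne, add_zero, MvPolynomial.X, MvPolynomial.monomial_mul, one_mul]
        congr 2
        ext i
        have hi : i ∈ s → d i ≠ 0 := fun hi => Finsupp.mem_support_iff.1 (h ▸ hi)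
        simp only [Finsupp.tsub_apply, Finsupp.add_apply, squarefreeExp_apply]
        split_ifs with his
        · have := hi his
          omega
        · omega
      · have hne : d.support ≠ s := fun h' => hd (h' ▸ hv)
        have he : d.support = s.erase v := by rw [← h, Finset.erase_insert hd]
        rw [if_neg hne, if_pos he, mul_zero, zero_add]
        congr 2
        ext i
        simp only [Finsupp.tsub_apply, Finsupp.add_apply, squarefreeExp_apply, Finset.mem_erase]
        by_cases hi : i = v
        · simp [hi, hv]
        · by_cases his : i ∈ s <;> simp [hi, his]
    · exact absurd (h ▸ Finset.mem_insert_self v _) hv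
    · have hne : d.support ≠ s := fun h' => h (by rw [h', Finset.insert_eq_self.2 hv])
      have hne' : d.support ≠ s.erase v := fun h' => h (by rw [h', Finset.insert_erase hv])
      rw [exactPart_monomial, exactPart_monomial, if_neg hne, if_neg hne', mul_zero, add_zero]
    · rfl

theorem mexp_eq_squarefreeExp {Y Z : Type} [Fintype Y] [Fintype Z] (p : Finset Y) (q : Finset Z) :
    mexp p q = squarefreeExp (p.disjSum q) := by
  simp [mexp, squarefreeExp, Finset.sum_disjSum]

theorem coeffMatrix_apply {F : Type} [Field F] {Y Z : Type} [Fintype Y] [Fintype Z]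
    (f : MvPolynomial (Y ⊕ Z) F) (p : Finset Y) (q : Finset Z) :
    coeffMatrix f p q = exactPart (p.disjSum q) f := by
  conv_rhs => rw [f.as_sum, map_sum]
  refine Finset.sum_congr rfl fun d _ => ?_
  rw [exactPart_monomial, mexp_eq_squarefreeExp]
  congr 1
  have hpq : p.image Sum.inl ∪ q.image Sum.inr = p.disjSum q := by
    ext (i | i) <;> simp
  rw [hpq, eq_iff_iff, Finset.Subset.antisymm_iff]
  refine and_congr_right fun _ => ⟨fun h i hi => ?_, fun h i => ?_⟩
  · have := h i
    rw [squarefreeExp_apply, if_pos hi] at this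
    exact Finsupp.mem_support_iff.2 (by omega)
  · rw [squarefreeExp_apply]
    split_ifs with hi
    · exact Nat.one_le_iff_ne_zero.2 (Finsupp.mem_support_iff.1 (h hi))
    · exact Nat.zero_le _

theorem coeffMatrix_add {F : Type} [Field F] {Y Z : Type} [Fintype Y] [Fintype Z]
    (f g : MvPolynomial (Y ⊕ Z) F) :
    coeffMatrix (f + g) = coeffMatrix f + coeffMatrix g := by
  ext1 p q
  simp [coeffMatrix_apply]

theorem coeffMatrix_mul_C {F : Type} [Field F] {Y Z : Type} [Fintype Y] [Fintype Z]
    (f : MvPolynomial (Y ⊕ Z) F) (c : F) :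
    coeffMatrix (f * MvPolynomial.C c) = (MvPolynomial.C c : MvPolynomial (Y ⊕ Z) F) • coeffMatrix f := by
  ext1 p q
  simp [coeffMatrix_apply, mul_comm f, ← MvPolynomial.smul_eq_C_mul]

/-- Multiplying by a polynomial in `Y` acts on `M_f` by multiplication with a matrix on the left. -/
theorem exists_coeffMatrix_mul_eq_mul_left {F : Type} [Field F] {Y Z : Type} [Fintype Y]
    [Fintype Z] (g : MvPolynomial (Y ⊕ Z) F) (hg : ∀ v ∈ g.vars, v.isLeft = true) :
    ∃ A : Matrix (Finset Y) (Finset Y) (MvPolynomial (Y ⊕ Z) F),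
      ∀ f, coeffMatrix (f * g) = A * coeffMatrix f := by
  have hg' : g ∈ MvPolynomial.supported F {v : Y ⊕ Z | v.isLeft = true} :=
    MvPolynomial.mem_supported.2 hg
  clear hg
  rw [MvPolynomial.supported] at hg'
  induction hg' using Algebra.adjoin_induction with
  | mem x hx =>
    obtain ⟨y | z, hv, rfl⟩ := hx
    · refine ⟨Matrix.of fun p p' => if y ∈ p then
        (if p = p' then MvPolynomial.X (Sum.inl y) else 0) +
          (if p.erase y = p' then 1 else 0) else 0, fun f => ?_⟩
      ext1 p q
      have he : (p.disjSum q).erase (Sum.inl y) = (p.erase y).disjSum q := by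
        ext (i | i) <;> simp
      rw [Matrix.mul_apply, coeffMatrix_apply, exactPart_mul_X, he]
      by_cases hy : y ∈ p <;>
        simp [hy, add_mul, Finset.sum_add_distrib, coeffMatrix_apply]
    · simp at hv
  | algebraMap c =>
    refine ⟨(MvPolynomial.C c : MvPolynomial (Y ⊕ Z) F) • 1, fun f => ?_⟩
    rw [MvPolynomial.algebraMap_eq, coeffMatrix_mul_C, Matrix.smul_mul, Matrix.one_mul]
  | add g h _ _ hg hh =>
    obtain ⟨A, hA⟩ := hg
    obtain ⟨B, hB⟩ := hh
    exact ⟨A + B, fun f => by rw [mul_add, coeffMatrix_add, hA, hB, Matrix.add_mul]⟩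
  | mul g h _ _ hg hh =>
    obtain ⟨A, hA⟩ := hg
    obtain ⟨B, hB⟩ := hh
    exact ⟨B * A, fun f => by rw [← mul_assoc, hB, hA, Matrix.mul_assoc]⟩

/-- Multiplying by a polynomial in `Z` acts on `M_f` by multiplication with a matrix on the
right. -/
theorem exists_coeffMatrix_mul_eq_mul_right {F : Type} [Field F] {Y Z : Type} [Fintype Y]
    [Fintype Z] (g : MvPolynomial (Y ⊕ Z) F) (hg : ∀ v ∈ g.vars, v.isRight = true) :
    ∃ A : Matrix (Finset Z) (Finset Z) (MvPolynomial (Y ⊕ Z) F),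
      ∀ f, coeffMatrix (f * g) = coeffMatrix f * A := by
  have hg' : g ∈ MvPolynomial.supported F {v : Y ⊕ Z | v.isRight = true} :=
    MvPolynomial.mem_supported.2 hg
  clear hg
  rw [MvPolynomial.supported] at hg'
  induction hg' using Algebra.adjoin_induction with
  | mem x hx =>
    obtain ⟨y | z, hv, rfl⟩ := hx
    · simp at hv
    · refine ⟨Matrix.of fun q' q => if z ∈ q then
        (if q = q' then MvPolynomial.X (Sum.inr z) else 0) +
          (if q.erase z = q' then 1 else 0) else 0, fun f => ?_⟩
      ext1 p q
      have he : (p.disjSum q).erase (Sum.inr z) = p.disjSum (q.erase z) := by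
        ext (i | i) <;> simp
      rw [Matrix.mul_apply, coeffMatrix_apply, exactPart_mul_X, he, mul_comm (MvPolynomial.X _)]
      by_cases hz : z ∈ q <;>
        simp [hz, mul_add, Finset.sum_add_distrib, coeffMatrix_apply]
  | algebraMap c =>
    refine ⟨(MvPolynomial.C c : MvPolynomial (Y ⊕ Z) F) • 1, fun f => ?_⟩
    rw [MvPolynomial.algebraMap_eq, coeffMatrix_mul_C, Matrix.mul_smul, Matrix.mul_one]
  | add g h _ _ hg hh =>
    obtain ⟨A, hA⟩ := hg
    obtain ⟨B, hB⟩ := hh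
    exact ⟨A + B, fun f => by rw [mul_add, coeffMatrix_add, hA, hB, Matrix.mul_add]⟩
  | mul g h _ _ hg hh =>
    obtain ⟨A, hA⟩ := hg
    obtain ⟨B, hB⟩ := hh
    exact ⟨A * B, fun f => by rw [← mul_assoc, hB, hA, Matrix.mul_assoc]⟩

theorem rank_eval_le_maxrank {F : Type} [Field F] {Y Z : Type} [Fintype Y] [Fintype Z]
    (f : MvPolynomial (Y ⊕ Z) F) (S : Y ⊕ Z → F) :
    ((coeffMatrix f).map (MvPolynomial.eval S)).rank ≤ maxrank f := by
  refine le_ciSup (f := fun S => ((coeffMatrix f).map (MvPolynomial.eval S)).rank)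
    ⟨Fintype.card (Finset Y), ?_⟩ S
  rintro _ ⟨T, rfl⟩
  exact Matrix.rank_le_card_height _

end PCM

/-- if all variables of `g` lie in `Y`, or all variables of `g` lie in `Z`,
then `maxrank(M_{fg}) ≤ maxrank(M_f)`. -/
theorem maxrank_mul_le_of_one_sided {F : Type} [Field F] {Y Z : Type} [Fintype Y] [Fintype Z]
    (f g : MvPolynomial (Y ⊕ Z) F)
    (hg : (∀ v ∈ g.vars, v.isLeft = true) ∨ (∀ v ∈ g.vars, v.isRight = true)) :
    PCM.maxrank (f * g) ≤ PCM.maxrank f := by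
  refine ciSup_le fun S => le_trans ?_ (PCM.rank_eval_le_maxrank f S)
  rcases hg with hg | hg
  · obtain ⟨A, hA⟩ := PCM.exists_coeffMatrix_mul_eq_mul_left g hg
    rw [hA, Matrix.map_mul]
    exact Matrix.rank_mul_le_right _ _
  · obtain ⟨A, hA⟩ := PCM.exists_coeffMatrix_mul_eq_mul_right g hg
    rw [hA, Matrix.map_mul]
    exact Matrix.rank_mul_le_left _ _
end
end

section
/- Let f be the iterated matrix multiplication polynomial, i.e., the (1,1) entry of A^1 A^2 ⋯ A^d. If f = Σ_{i=1}^k Π_{j=1}^{m_i} l_{i,j}, where each l_{i,j} is a homogeneous linear form in the variables X with coefficients in F (a homogeneous ΣΠΣ representation with top fan-in k), then k · 2^d ≥ n^{d−1}, i.e., k ≥ n^{d−1}/2^d. -/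
open scoped Classical

noncomputable section

namespace IMM

/-- Indices of the odd-numbered matrices `A^1, A^3, …` (0-based even), together with a
position in an `n × n` matrix: the `Y`-variables of the partition `B`. -/
abbrev OddV (n d : ℕ) := {i : Fin d // i.val % 2 = 0} × Fin n × Fin n

/-- Indices of the even-numbered matrices `A^2, A^4, …` (0-based odd), together with a
position in an `n × n` matrix: the `Z`-variables of the partition `B`. -/
abbrev EvenV (n d : ℕ) := {i : Fin d // i.val % 2 = 1} × Fin n × Fin n

/-- The matrix `A^{i+1}` of distinct variables, with variables of odd-numbered matrices
renamed (by the partition `B`) to `Y`-variables and those of even-numbered matrices to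
`Z`-variables. -/
noncomputable def matB (F : Type) [Field F] (n d : ℕ) (i : Fin d) :
    Matrix (Fin n) (Fin n) (MvPolynomial (OddV n d ⊕ EvenV n d) F) := fun j k =>
  if h : i.val % 2 = 0 then MvPolynomial.X (Sum.inl (⟨i, h⟩, j, k))
  else MvPolynomial.X
    (Sum.inr (⟨i, (Nat.mod_two_eq_zero_or_one i.val).resolve_left h⟩, j, k))

/-- The `(j,k)` entry of the product `A^1 A^2 ⋯ A^d`, after the renaming `B`. -/
noncomputable def imm (F : Type) [Field F] (n d : ℕ) (j k : Fin n) :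
    MvPolynomial (OddV n d ⊕ EvenV n d) F :=
  (List.ofFn (matB F n d)).prod j k

end IMM

namespace MvPolynomial

variable {σ R : Type*} [CommRing R]

/-- Across disjoint sets of variables, coefficients of a product factor. -/
theorem coeff_add_mul_of_mem_supported {s t : Set σ} (hst : Disjoint s t)
    {p q : MvPolynomial σ R} (hp : p ∈ supported R s) (hq : q ∈ supported R t)
    {a b : σ →₀ ℕ} (ha : (a.support : Set σ) ⊆ s) (hb : (b.support : Set σ) ⊆ t) :
    coeff (a + b) (p * q) = coeff a p * coeff b q := by
  classical
  rw [mem_supported] at hp hq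
  have hvanish {u v : Set σ} (huv : Disjoint u v) {e : σ →₀ ℕ} (he : (e.support : Set σ) ⊆ u)
      {i : σ} (hi : i ∈ v) : e i = 0 := by
    by_contra h
    exact Set.disjoint_left.mp huv (he (by simpa using h)) hi
  have hsupp {r : MvPolynomial σ R} {u : Set σ} (hr : (r.vars : Set σ) ⊆ u) {e : σ →₀ ℕ}
      (he : coeff e r ≠ 0) : (e.support : Set σ) ⊆ u := fun i hi ↦
    hr ((mem_vars_iff_mem_support i).mpr ⟨e, mem_support_iff.mpr he, hi⟩)
  rw [coeff_mul]
  refine Finset.sum_eq_single (a, b) ?_ (by simp)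
  rintro ⟨x, y⟩ hxy hne
  rw [Finset.HasAntidiagonal.mem_antidiagonal] at hxy
  by_contra h
  have hx := hsupp hp (left_ne_zero_of_mul h)
  have hy := hsupp hq (right_ne_zero_of_mul h)
  have key (i : σ) : x i = a i ∧ y i = b i := by
    have hi : x i + y i = a i + b i := DFunLike.congr_fun hxy i
    by_cases his : i ∈ s
    · rw [hvanish hst.symm hy his, hvanish hst.symm hb his] at hi ⊢
      exact ⟨hi, rfl⟩
    · have hxi : x i = 0 := by
        by_contra h'
        exact his (hx (by simpa using h'))
      have hai : a i = 0 := by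
        by_contra h'
        exact his (ha (by simpa using h'))
      omega
  exact hne (Prod.ext (Finsupp.ext fun i ↦ (key i).1) (Finsupp.ext fun i ↦ (key i).2))

/-- A linear form splits along a partition of the variables. -/
theorem IsHomogeneous.exists_add_mem_supported {l : MvPolynomial σ R} (hl : l.IsHomogeneous 1)
    {s t : Set σ} (hst : s ∪ t = Set.univ) :
    ∃ y ∈ supported R s, ∃ z ∈ supported R t, l = y + z := by
  have hspan : l ∈ Submodule.span R (Set.range (X : σ → MvPolynomial σ R)) := by
    rwa [← homogeneousSubmodule_one_eq_span_X, mem_homogeneousSubmodule]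
  have hle : Submodule.span R (Set.range (X : σ → MvPolynomial σ R)) ≤
      Subalgebra.toSubmodule (supported R s) ⊔ Subalgebra.toSubmodule (supported R t) := by
    rw [Submodule.span_le]
    rintro _ ⟨i, rfl⟩
    obtain hi | hi : i ∈ s ∪ t := hst ▸ Set.mem_univ i
    · exact Submodule.mem_sup_left (Algebra.subset_adjoin ⟨i, hi, rfl⟩)
    · exact Submodule.mem_sup_right (Algebra.subset_adjoin ⟨i, hi, rfl⟩)
  obtain ⟨y, hy, z, hz, h⟩ := Submodule.mem_sup.mp (hle hspan)
  exact ⟨y, hy, z, hz, h.symm⟩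

end MvPolynomial

/-- An entry of a product of square matrices is a sum over paths. -/
theorem Matrix.list_ofFn_prod_apply {R ι : Type*} [CommSemiring R] [Fintype ι] [DecidableEq ι]
    {d : ℕ} (A : Fin d → Matrix ι ι R) (j k : ι) :
    (List.ofFn A).prod j k = ∑ v : Fin (d + 1) → ι,
      if v 0 = j ∧ v (Fin.last d) = k then ∏ i, A i (v i.castSucc) (v i.succ) else 0 := by
  induction d generalizing j with
  | zero =>
    rw [← (Equiv.funUnique (Fin 1) ι).symm.sum_comp]
    simp only [List.ofFn_zero, List.prod_nil, Matrix.one_apply, Equiv.funUnique_symm_apply,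
      uniqueElim_const, Finset.univ_eq_empty, Finset.prod_empty, Fin.last_zero]
    rw [Finset.sum_eq_single j (fun b _ hb ↦ if_neg fun h ↦ hb h.1) (by simp)]
    simp
  | succ d ih =>
    rw [List.ofFn_succ, List.prod_cons, Matrix.mul_apply]
    simp only [ih, Finset.mul_sum]
    conv_rhs =>
      rw [← (Fin.consEquiv fun _ : Fin (d + 2) ↦ ι).sum_comp, Fintype.sum_prod_type,
        Finset.sum_comm]
    rw [Finset.sum_comm]
    refine Fintype.sum_congr _ _ fun v ↦ ?_
    rw [Finset.sum_eq_single (v 0)]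
    · rw [Finset.sum_eq_single j]
      · simp [Fin.consEquiv, Fin.prod_univ_succ (n := d), ← Fin.succ_last]
      · intro x _ hx
        simp [Fin.consEquiv, hx]
      · simp
    · intro x _ hx
      simp [hx.symm]
    · simp

namespace IMM

variable {n d : ℕ}

/-- The variable in position `(j, k)` of the matrix with index `i`. -/
def var (i : Fin d) (j k : Fin n) : OddV n d ⊕ EvenV n d :=
  if h : i.val % 2 = 0 then Sum.inl (⟨i, h⟩, j, k)
  else Sum.inr (⟨i, (Nat.mod_two_eq_zero_or_one i.val).resolve_left h⟩, j, k)

theorem matB_apply (F : Type) [Field F] (i : Fin d) (j k : Fin n) :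
    matB F n d i j k = MvPolynomial.X (var i j k) := by
  unfold matB var
  split_ifs <;> rfl

theorem var_inj {i i' : Fin d} {j j' k k' : Fin n} :
    var i j k = var i' j' k' ↔ i = i' ∧ j = j' ∧ k = k' := by
  refine ⟨fun h ↦ ?_, by rintro ⟨rfl, rfl, rfl⟩; rfl⟩
  unfold var at h
  split_ifs at h <;> simpa using h

/-- The exponent vector of the part of a path through the matrices of index parity `r`. -/
def pathExp (r : ℕ) (v : Fin (d + 1) → Fin n) : (OddV n d ⊕ EvenV n d) →₀ ℕ :=
  ∑ i : Fin d with i.val % 2 = r, Finsupp.single (var i (v i.castSucc) (v i.succ)) 1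

theorem pathExp_apply (r : ℕ) (v : Fin (d + 1) → Fin n) (i : Fin d) (j k : Fin n) :
    pathExp r v (var i j k) =
      if i.val % 2 = r ∧ v i.castSucc = j ∧ v i.succ = k then 1 else 0 := by
  rw [pathExp, Finsupp.finsetSum_apply, Finset.sum_filter]
  simp only [Finsupp.single_apply, var_inj]
  rw [Finset.sum_eq_single i]
  · simp [ite_and]
  · intro b _ hb
    simp [hb]
  · simp

theorem support_pathExp_zero (v : Fin (d + 1) → Fin n) :
    ((pathExp 0 v).support : Set (OddV n d ⊕ EvenV n d)) ⊆ Set.range Sum.inl := by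
  rintro (x | ⟨⟨i, hi⟩, j, k⟩) hx
  · exact ⟨x, rfl⟩
  · have : (Sum.inr (⟨i, hi⟩, j, k) : OddV n d ⊕ EvenV n d) = var i j k := by simp [var, hi]
    simp [this, pathExp_apply, hi] at hx

theorem support_pathExp_one (v : Fin (d + 1) → Fin n) :
    ((pathExp 1 v).support : Set (OddV n d ⊕ EvenV n d)) ⊆ Set.range Sum.inr := by
  rintro (⟨⟨i, hi⟩, j, k⟩ | x) hx
  · have : (Sum.inl (⟨i, hi⟩, j, k) : OddV n d ⊕ EvenV n d) = var i j k := by simp [var, hi]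
    simp [this, pathExp_apply, hi] at hx
  · exact ⟨x, rfl⟩

theorem degree_pathExp_add (v w : Fin (d + 1) → Fin n) :
    (pathExp 0 v + pathExp 1 w).degree = d := by
  have h (i : Fin d) : i.val % 2 = 1 ↔ ¬ i.val % 2 = 0 := by omega
  simp only [pathExp, map_add, map_sum, Finsupp.degree_single, h]
  rw [Finset.sum_filter_add_sum_filter_not]
  simp

theorem pathExp_zero_add_one (v : Fin (d + 1) → Fin n) :
    pathExp 0 v + pathExp 1 v =
      ∑ i : Fin d, Finsupp.single (var i (v i.castSucc) (v i.succ)) 1 := by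
  have h (i : Fin d) : i.val % 2 = 1 ↔ ¬ i.val % 2 = 0 := by omega
  simp only [pathExp, h]
  rw [Finset.sum_filter_add_sum_filter_not]

/-- The paths of length `d` from the first vertex to itself. -/
abbrev ClosedPath (n d : ℕ) (hn : 0 < n) :=
  {v : Fin (d + 1) → Fin n // v 0 = ⟨0, hn⟩ ∧ v (Fin.last d) = ⟨0, hn⟩}

/-- Either half of the monomial of a closed path determines the path. -/
theorem eq_of_pathExp_add_eq {hn : 0 < n} {u v w : ClosedPath n d hn}
    (h : pathExp 0 u.1 + pathExp 1 u.1 = pathExp 0 v.1 + pathExp 1 w.1) : u = v ∧ u = w := by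
  have hstep (i : Fin d) :
      (i.val % 2 = 0 → v.1 i.castSucc = u.1 i.castSucc ∧ v.1 i.succ = u.1 i.succ) ∧
      (i.val % 2 = 1 → w.1 i.castSucc = u.1 i.castSucc ∧ w.1 i.succ = u.1 i.succ) := by
    have hi := DFunLike.congr_fun h (var i (u.1 i.castSucc) (u.1 i.succ))
    simp only [Finsupp.add_apply, pathExp_apply] at hi
    constructor <;> intro hr <;> by_contra hc <;> simp [hr, hc] at hi
  have hagree {x : ClosedPath n d hn} (r : ℕ) (hr : r < 2)
      (hx : ∀ i : Fin d, i.val % 2 = r →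
        x.1 i.castSucc = u.1 i.castSucc ∧ x.1 i.succ = u.1 i.succ) : u = x := by
    refine Subtype.ext (funext fun t ↦ ?_)
    by_cases h0 : t = 0
    · rw [h0, u.2.1, x.2.1]
    by_cases hl : t = Fin.last d
    · rw [hl, u.2.2, x.2.2]
    by_cases hp : t.val % 2 = r
    · obtain ⟨i, rfl⟩ := Fin.exists_castSucc_eq.mpr hl
      exact (hx i hp).1.symm
    · obtain ⟨i, rfl⟩ := Fin.exists_succ_eq.mpr h0
      exact (hx i (by rw [Fin.val_succ] at hp; omega)).2.symm
  exact ⟨hagree 0 (by omega) fun i ↦ (hstep i).1, hagree 1 (by omega) fun i ↦ (hstep i).2⟩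

theorem imm_eq_sum (F : Type) [Field F] (hn : 0 < n) :
    imm F n d ⟨0, hn⟩ ⟨0, hn⟩ =
      ∑ u : ClosedPath n d hn, MvPolynomial.monomial (pathExp 0 u.1 + pathExp 1 u.1) 1 := by
  rw [imm, Matrix.list_ofFn_prod_apply, ← Finset.sum_filter]
  rw [Finset.sum_subtype (p := fun v ↦ v 0 = ⟨0, hn⟩ ∧ v (Fin.last d) = ⟨0, hn⟩) _
    (fun v ↦ by rw [Finset.mem_filter_univ])]
  refine Finset.sum_congr rfl fun v _ ↦ ?_
  simp only [pathExp_zero_add_one, MvPolynomial.monomial_sum_one, matB_apply, MvPolynomial.X]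

theorem coeff_imm (F : Type) [Field F] {hn : 0 < n} (v w : ClosedPath n d hn) :
    MvPolynomial.coeff (pathExp 0 v.1 + pathExp 1 w.1) (imm F n d ⟨0, hn⟩ ⟨0, hn⟩) =
      if v = w then 1 else 0 := by
  rw [imm_eq_sum, MvPolynomial.coeff_sum]
  simp only [MvPolynomial.coeff_monomial]
  split_ifs with h
  · subst h
    rw [Finset.sum_eq_single v (fun u _ hu ↦ if_neg fun h ↦ hu (eq_of_pathExp_add_eq h).1)
      (by simp), if_pos rfl]
  · refine Finset.sum_eq_zero fun u _ ↦ if_neg fun hu ↦ h ?_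
    obtain ⟨rfl, rfl⟩ := eq_of_pathExp_add_eq hu
    rfl

theorem pow_le_card_closedPath (hn : 0 < n) (hd : 2 ≤ d) :
    n ^ (d - 1) ≤ Fintype.card (ClosedPath n d hn) := by
  obtain ⟨e, rfl⟩ : ∃ e, d = e + 1 := ⟨d - 1, by omega⟩
  let g (u : Fin e → Fin n) : ClosedPath n (e + 1) hn :=
    ⟨Fin.cons ⟨0, hn⟩ (Fin.snoc u ⟨0, hn⟩ : Fin (e + 1) → Fin n), by
      simp [← Fin.succ_last]⟩
  have hg : Function.Injective g := fun u u' h ↦ by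
    have h' := Fin.cons_right_injective (α := fun _ ↦ Fin n) _ (congrArg Subtype.val h)
    exact Fin.snoc_left_injective (α := fun _ ↦ Fin n) _ h'
  simpa using Fintype.card_le_of_injective g hg

end IMM

/-- if the `(1,1)` entry of `A^1 A^2 ⋯ A^d` has a homogeneous ΣΠΣ
representation with top fan-in `k` (each summand a product of homogeneous linear
forms), then `k · 2^d ≥ n^{d-1}`. -/
theorem imm_hom_sps_lower_bound {F : Type} [Field F] (n d : ℕ) (hn : 0 < n) (hd : 2 ≤ d)
    (k : ℕ) (m : ℕ → ℕ)
    (l : ℕ → ℕ → MvPolynomial (IMM.OddV n d ⊕ IMM.EvenV n d) F)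
    (hl : ∀ i ∈ Finset.range k, ∀ j ∈ Finset.range (m i), (l i j).IsHomogeneous 1)
    (hrep : IMM.imm F n d ⟨0, hn⟩ ⟨0, hn⟩ =
      ∑ i ∈ Finset.range k, ∏ j ∈ Finset.range (m i), l i j) :
    n ^ (d - 1) ≤ k * 2 ^ d := by
  have hsplit : ∀ i ∈ Finset.range k, ∀ j ∈ Finset.range (m i),
      ∃ y ∈ MvPolynomial.supported F (Set.range Sum.inl),
        ∃ z ∈ MvPolynomial.supported F (Set.range Sum.inr), l i j = y + z := fun i hi j hj ↦
    (hl i hi j hj).exists_add_mem_supported Set.range_inl_union_range_inr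
  choose! y hy z hz hyz using hsplit
  let T := Finset.range k ×ˢ (Finset.range d).powerset
  let B : Matrix (IMM.ClosedPath n d hn) T F := fun v c ↦
    if m c.1.1 = d then MvPolynomial.coeff (IMM.pathExp 0 v.1) (∏ j ∈ c.1.2, y c.1.1 j) else 0
  let C : Matrix T (IMM.ClosedPath n d hn) F := fun c w ↦
    MvPolynomial.coeff (IMM.pathExp 1 w.1) (∏ j ∈ Finset.range d \ c.1.2, z c.1.1 j)
  have hBC : B * C = 1 := by
    ext v w
    rw [Matrix.one_apply, ← IMM.coeff_imm F v w, hrep, MvPolynomial.coeff_sum, Matrix.mul_apply,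
      Finset.sum_coe_sort T fun c ↦ (if m c.1 = d then
        MvPolynomial.coeff (IMM.pathExp 0 v.1) (∏ j ∈ c.2, y c.1 j) else 0) *
        MvPolynomial.coeff (IMM.pathExp 1 w.1) (∏ j ∈ Finset.range d \ c.2, z c.1 j),
      Finset.sum_product]
    refine Finset.sum_congr rfl fun i hi ↦ ?_
    by_cases hm : m i = d
    · rw [hm, Finset.prod_congr rfl fun j hj ↦ hyz i hi j (hm ▸ hj), Finset.prod_add,
        MvPolynomial.coeff_sum]
      refine Finset.sum_congr rfl fun t ht ↦ ?_
      rw [if_pos hm, MvPolynomial.coeff_add_mul_of_mem_supported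
        Set.isCompl_range_inl_range_inr.disjoint
        (Subalgebra.prod_mem _ fun j hj ↦ hy i hi j (hm ▸ Finset.mem_powerset.mp ht hj))
        (Subalgebra.prod_mem _ fun j hj ↦ hz i hi j (hm ▸ (Finset.mem_sdiff.mp hj).1))
        (IMM.support_pathExp_zero _) (IMM.support_pathExp_one _)]
    · have hhom := MvPolynomial.IsHomogeneous.prod (Finset.range (m i)) (l i) (fun _ ↦ 1) (hl i hi)
      rw [hhom.coeff_eq_zero (by simpa [IMM.degree_pathExp_add] using Ne.symm hm)]
      simp [hm]
  calc n ^ (d - 1) ≤ Fintype.card (IMM.ClosedPath n d hn) := IMM.pow_le_card_closedPath hn hd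
    _ = (B * C).rank := by rw [hBC, Matrix.rank_one]
    _ ≤ B.rank := Matrix.rank_mul_le_left _ _
    _ ≤ Fintype.card T := Matrix.rank_le_card_width _
    _ = k * 2 ^ d := by simp [T]
end
end

section
/- Let F be a field of characteristic zero and let l_1,…,l_r be homogeneous linear forms in F[Y ∪ Z]. Suppose P = Σ_{i=1}^t Π_{u=1}^d l_{α(i,u)}, where each α(i,u) ∈ [r] (so P is a sum of products of exactly d forms from the list, repetitions allowed). Then P can be written as P = Σ_{q=1}^v c_q L_q^d, where v ≤ C(d+r, r) (the binomial coefficient), each c_q ∈ F, and each L_q is a homogeneous linear form of the shape L_q = Σ_{i=1}^r γ_i l_i with nonnegative integers γ_i satisfying Σ_{i=1}^r γ_i ≤ d. -/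
open scoped Classical

noncomputable section

/-- The polarization identity, by inclusion-exclusion over the sets of omitted summands. -/
theorem factorial_mul_prod_eq_sum_powerset {R : Type*} [CommRing R] (d : ℕ) (x : Fin d → R) :
    (d.factorial : R) * ∏ u, x u =
      ∑ s : Finset (Fin d), (-1 : R) ^ s.card * (∑ u ∈ sᶜ, x u) ^ d := by
  have inner (f : Fin d → Fin d) :
      (∑ s : Finset (Fin d), if ∀ j, f j ∈ sᶜ then (-1 : R) ^ s.card else 0) =
        if Function.Bijective f then 1 else 0 := by
    have hfilter : (Finset.univ.filter fun s : Finset (Fin d) => ∀ j, f j ∈ sᶜ) =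
        ((Finset.univ.image f)ᶜ).powerset := by
      ext s
      simp only [Finset.mem_filter, Finset.mem_univ, true_and, Finset.mem_compl,
        Finset.mem_powerset, Finset.subset_iff, Finset.mem_image, not_exists]
      exact ⟨fun h a ha j hj => h j (hj ▸ ha), fun h j hj => h hj j rfl⟩
    have hcompl : (Finset.univ.image f)ᶜ = ∅ ↔ Function.Bijective f := by
      rw [Finset.compl_eq_empty_iff, ← Finite.surjective_iff_bijective]
      simp [Finset.eq_univ_iff_forall, Function.Surjective]
    rw [← Finset.sum_filter, hfilter]
    have key := congrArg (Int.cast : ℤ → R)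
      (Finset.sum_powerset_neg_one_pow_card (x := (Finset.univ.image f)ᶜ))
    push_cast at key
    simpa only [hcompl] using key
  calc (d.factorial : R) * ∏ u, x u
      = ∑ σ : Equiv.Perm (Fin d), ∏ j, x (σ j) := by
        simp [Equiv.prod_comp, Fintype.card_perm]
    _ = ∑ f : Fin d → Fin d, if Function.Bijective f then ∏ j, x (f j) else 0 := by
        rw [← Finset.sum_filter]
        exact Finset.sum_bij (fun σ _ => σ)
          (fun σ _ => Finset.mem_filter.2 ⟨Finset.mem_univ _, σ.bijective⟩)
          (fun _ _ _ _ h => DFunLike.coe_injective h)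
          (fun f hf => ⟨Equiv.ofBijective f (Finset.mem_filter.1 hf).2, by simp, rfl⟩)
          (fun _ _ => rfl)
    _ = ∑ f : Fin d → Fin d, ∑ s : Finset (Fin d),
          if ∀ j, f j ∈ sᶜ then (-1 : R) ^ s.card * ∏ j, x (f j) else 0 := by
        refine Finset.sum_congr rfl fun f _ => ?_
        simpa [Finset.sum_mul, ite_mul] using (congrArg (· * ∏ j, x (f j)) (inner f)).symm
    _ = ∑ s : Finset (Fin d), (-1 : R) ^ s.card * (∑ u ∈ sᶜ, x u) ^ d := by
        rw [Finset.sum_comm]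
        refine Finset.sum_congr rfl fun s _ => ?_
        rw [Finset.sum_pow', Finset.mul_sum, ← Finset.sum_filter]
        exact Finset.sum_congr (by ext; simp [Fintype.mem_piFinset]) fun _ _ => rfl

theorem sum_count_some_le {ι : Type*} [Fintype ι] [DecidableEq ι] (m : Multiset (Option ι)) :
    ∑ i, m.count (some i) ≤ m.card := by
  have h := Multiset.sum_count_eq_card (s := Finset.univ) (m := m) fun a _ => Finset.mem_univ a
  rw [Fintype.sum_option] at h
  omega

/-- Multisets of size `d` in `Option ι` parametrize the multiplicities `ι → ℕ` of sum at most
`d`, the element `none` taking up the slack. -/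
theorem prod_mem_span_pow {F A ι : Type*} [Field F] [CharZero F] [CommRing A] [Algebra F A]
    [Fintype ι] [DecidableEq ι] (l : ι → A) (d : ℕ) (α : Fin d → ι) :
    ∏ u, l (α u) ∈ Submodule.span F (Set.range fun s : Sym (Option ι) d =>
      (∑ i, (s : Multiset (Option ι)).count (some i) • l i) ^ d) := by
  have hd : (d.factorial : F) ≠ 0 := by exact_mod_cast d.factorial_ne_zero
  have hprod : ∏ u, l (α u) = (d.factorial : F)⁻¹ • ∑ s : Finset (Fin d),
      (-1 : F) ^ s.card • (∑ u ∈ sᶜ, l (α u)) ^ d := by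
    rw [eq_inv_smul_iff₀ hd]
    simpa [Algebra.smul_def] using factorial_mul_prod_eq_sum_powerset d fun u => l (α u)
  rw [hprod]
  refine Submodule.smul_mem _ _ (Submodule.sum_mem _ fun s _ => Submodule.smul_mem _ _
    (Submodule.subset_span ⟨⟨Finset.univ.val.map fun u => if u ∈ s then none else some (α u),
      by simp⟩, ?_⟩))
  have hcount (i : ι) : (Finset.univ.val.map fun u => if u ∈ s then none else some (α u)).count
      (some i) = ∑ u ∈ sᶜ, if α u = i then 1 else 0 := by
    rw [Multiset.count_map, ← Finset.filter_val, Finset.card_val, Finset.sum_boole, Nat.cast_id]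
    congr 1
    ext u
    by_cases hu : u ∈ s <;> simp [hu, eq_comm]
  simp only [Sym.coe_mk, hcount, Finset.sum_smul]
  rw [Finset.sum_comm]
  simp

/-- over a field of characteristic zero, a sum of products of exactly `d`
homogeneous linear forms taken from `l_1, …, l_r` can be rewritten as a sum of at most
`C(d+r, r)` scaled `d`-th powers of homogeneous linear forms of the shape
`Σ_i γ_i l_i` with `γ_i ∈ ℕ` and `Σ_i γ_i ≤ d`. -/
theorem sps_as_sum_of_powers {F : Type} [Field F] [CharZero F] {Y Z : Type}
    [Fintype Y] [Fintype Z] (r t d : ℕ)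
    (l : Fin r → MvPolynomial (Y ⊕ Z) F) (hl : ∀ i, (l i).IsHomogeneous 1)
    (α : Fin t → Fin d → Fin r) (P : MvPolynomial (Y ⊕ Z) F)
    (hP : P = ∑ i : Fin t, ∏ u : Fin d, l (α i u)) :
    ∃ (v : ℕ) (c : Fin v → F) (γ : Fin v → Fin r → ℕ),
      v ≤ (d + r).choose r ∧
      (∀ q : Fin v, ∑ i : Fin r, γ q i ≤ d) ∧
      P = ∑ q : Fin v, c q • (∑ i : Fin r, γ q i • l i) ^ d := by
  have hmem : P ∈ Submodule.span F (Set.range fun s : Sym (Option (Fin r)) d =>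
      (∑ i, (s : Multiset (Option (Fin r))).count (some i) • l i) ^ d) :=
    hP ▸ Submodule.sum_mem _ fun i _ => prod_mem_span_pow l d (α i)
  obtain ⟨c, hc⟩ := (Submodule.mem_span_range_iff_exists_fun F).1 hmem
  let e := (Fintype.equivFin (Sym (Option (Fin r)) d)).symm
  refine ⟨Fintype.card (Sym (Option (Fin r)) d), c ∘ e,
    fun q i => (e q : Multiset (Option (Fin r))).count (some i), ?_, fun q => ?_, ?_⟩
  · rw [Sym.card_sym_eq_choose, Fintype.card_option, Fintype.card_fin,
      show r + 1 + d - 1 = d + r by omega, Nat.choose_symm_add]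
  · exact (sum_count_some_le _).trans_eq (e q).2
  · rw [← hc]
    exact (e.sum_comp _).symm
end
end

section
/- Let d = 2d' be an even integer and, for i, j ∈ [n], let f_{ij} denote the (i,j) entry of the matrix product A^1 A^2 ⋯ A^d. Let B be the partition sending all variables of odd-indexed matrices to Y-variables and all variables of even-indexed matrices to Z-variables. Then: (1) for all i, j ∈ [n], the matrix M_{f_{ij}^B} (equivalently, since f_{ij}^B is multilinear, its partial derivatives matrix) has rank exactly n^{d−1}; and (2) for every i ∈ [n] and all j ≠ j' ∈ [n], the set of columns (monic multilinear monomials in the Z-variables) at which M_{f_{ij}^B} has a nonzero entry is disjoint from the set of columns at which M_{f_{ij'}^B} has a nonzero entry. -/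
open scoped Classical

noncomputable section

/-- A matrix that is the indicator of pairs `(r w, c w)`, with `r` and `c` injective, has rank
the number of indices `w`. -/
theorem Matrix.rank_eq_card_of_apply_eq_sum {F α β ι : Type*} [Field F] [DecidableEq α]
    [DecidableEq β] [Fintype β] [Fintype ι]
    (M : Matrix α β F) (r : ι → α) (c : ι → β)
    (hr : Function.Injective r) (hc : Function.Injective c)
    (hM : ∀ p q, M p q = ∑ w, if p = r w ∧ q = c w then 1 else 0) :
    M.rank = Fintype.card ι := by
  apply le_antisymm
  · have hfac : M = (Matrix.of fun p w => if p = r w then (1 : F) else 0) *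
        (Matrix.of fun w q => if q = c w then (1 : F) else 0) := by
      ext p q
      rw [hM, Matrix.mul_apply]
      exact Finset.sum_congr rfl fun w _ => by
        simp only [Matrix.of_apply, ite_and, ite_mul, one_mul, zero_mul]
    rw [hfac]
    exact (Matrix.rank_mul_le_left _ _).trans (Matrix.rank_le_card_width _)
  · have hsub : M.submatrix r c = 1 := by
      ext w w'
      simp only [Matrix.submatrix_apply, hM, hr.eq_iff, hc.eq_iff, Matrix.one_apply]
      simp only [ite_and, Finset.sum_ite_eq, Finset.mem_univ, if_true, eq_comm]
    rw [← Matrix.rank_one (R := F) (n := ι), ← hsub]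
    exact Matrix.rank_submatrix_le M r c

namespace PCM

theorem mexp_apply_inl {Y Z : Type} [Fintype Y] [Fintype Z] (p : Finset Y) (q : Finset Z)
    (y : Y) : mexp p q (Sum.inl y) = if y ∈ p then 1 else 0 := by
  simp [mexp, Finsupp.single_apply]

theorem mexp_apply_inr {Y Z : Type} [Fintype Y] [Fintype Z] (p : Finset Y) (q : Finset Z)
    (z : Z) : mexp p q (Sum.inr z) = if z ∈ q then 1 else 0 := by
  simp [mexp, Finsupp.single_apply]

theorem mexp_eq_mexp_iff {Y Z : Type} [Fintype Y] [Fintype Z] {p p' : Finset Y}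
    {q q' : Finset Z} : mexp p q = mexp p' q' ↔ p = p' ∧ q = q' := by
  refine ⟨fun h => ⟨?_, ?_⟩, by rintro ⟨rfl, rfl⟩; rfl⟩
  · ext y
    have := DFunLike.congr_fun h (Sum.inl y)
    rw [mexp_apply_inl, mexp_apply_inl] at this
    split_ifs at this <;> simp_all
  · ext z
    have := DFunLike.congr_fun h (Sum.inr z)
    rw [mexp_apply_inr, mexp_apply_inr] at this
    split_ifs at this <;> simp_all

end PCM

namespace IMM

/-- The vertex sequence `i, u 0, …, u (m - 1), j`. -/
def path {ι : Type*} {m : ℕ} (i j : ι) (u : Fin m → ι) : Fin (m + 2) → ι :=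
  Fin.cons (α := fun _ => ι) i (Fin.snoc (α := fun _ => ι) u j)

theorem path_cons {ι : Type*} {m : ℕ} (i j k : ι) (u : Fin m → ι) :
    path i j (Fin.cons (α := fun _ => ι) k u) =
      Fin.cons (α := fun _ => ι) i (path k j u) := by
  rw [path, path, ← Fin.cons_snoc_eq_snoc_cons]

theorem path_succ_castSucc {ι : Type*} {m : ℕ} (i j : ι) (u : Fin m → ι) (t : Fin m) :
    path i j u t.castSucc.succ = u t := by
  simp [path]

theorem path_last {ι : Type*} {m : ℕ} (i j : ι) (u : Fin m → ι) :
    path i j u (Fin.last m).succ = j := by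
  simp [path]

/-- The entries of a product of matrices are sums over paths. -/
theorem prod_ofFn_apply {R ι : Type*} [CommSemiring R] [Fintype ι] [DecidableEq ι] (m : ℕ)
    (A : Fin (m + 1) → Matrix ι ι R) (i j : ι) :
    (List.ofFn A).prod i j =
      ∑ u : Fin m → ι, ∏ t, A t (path i j u t.castSucc) (path i j u t.succ) := by
  induction m generalizing i with
  | zero => simp [path, Fin.snoc]
  | succ m ih =>
    rw [List.ofFn_succ, List.prod_cons, Matrix.mul_apply,
      ← (Fin.consEquiv fun _ : Fin (m + 1) => ι).sum_comp, Fintype.sum_prod_type]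
    refine Finset.sum_congr rfl fun k _ => ?_
    rw [ih, Finset.mul_sum]
    refine Finset.sum_congr rfl fun u _ => ?_
    refine Eq.trans ?_ (Fin.prod_univ_succ _).symm
    rw [show Fin.consEquiv (fun _ : Fin (m + 1) => ι) (k, u) = Fin.cons k u from rfl, path_cons]
    simp only [ ← Fin.succ_castSucc, Fin.cons_succ,
      Fin.castSucc_zero, Fin.cons_zero]
    rfl

/-- The edges of a vertex sequence at the positions congruent to `r` modulo `2`. -/
def edges {n d : ℕ} (r : ℕ) (v : Fin (d + 1) → Fin n) :
    Finset ({t : Fin d // t.val % 2 = r} × Fin n × Fin n) :=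
  Finset.univ.image fun t => (t, v t.1.castSucc, v t.1.succ)

theorem eq_of_edges_eq {n d r : ℕ} {v v' : Fin (d + 1) → Fin n} (h : edges r v = edges r v')
    (t : Fin d) (ht : t.val % 2 = r) :
    v t.castSucc = v' t.castSucc ∧ v t.succ = v' t.succ := by
  have hmem : ((⟨t, ht⟩, v t.castSucc, v t.succ) :
      {t : Fin d // t.val % 2 = r} × Fin n × Fin n) ∈ edges r v' :=
    h ▸ Finset.mem_image_of_mem _ (Finset.mem_univ (⟨t, ht⟩ : {t : Fin d // t.val % 2 = r}))
  obtain ⟨s, -, hs⟩ := Finset.mem_image.1 hmem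
  simp only [Prod.mk.injEq] at hs
  obtain ⟨rfl, h1, h2⟩ := hs
  exact ⟨h1.symm, h2.symm⟩

theorem sum_edges {n d r : ℕ} {M : Type*} [AddCommMonoid M] (v : Fin (d + 1) → Fin n)
    (g : {t : Fin d // t.val % 2 = r} × Fin n × Fin n → M) :
    ∑ e ∈ edges r v, g e =
      ∑ t : {t : Fin d // t.val % 2 = r}, g (t, v t.1.castSucc, v t.1.succ) :=
  Finset.sum_image fun _ _ _ _ h => (Prod.mk.inj h).1

theorem edges_path_injective {n m r : ℕ} (hr : r < 2) (i j : Fin n) :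
    Function.Injective fun u : Fin m → Fin n => edges r (path i j u) := by
  intro u u' h
  funext s
  rw [← path_succ_castSucc i j u s, ← path_succ_castSucc i j u' s]
  by_cases hs : s.val % 2 = r
  · exact (eq_of_edges_eq h s.castSucc hs).2
  · rw [Fin.succ_castSucc]
    exact (eq_of_edges_eq h s.succ (by rw [Fin.val_succ]; omega)).1

/-- The product of the variables along a vertex sequence is a monic multilinear monomial. -/
theorem prod_matB {F : Type} [Field F] {n d : ℕ} (v : Fin (d + 1) → Fin n) :
    ∏ t, matB F n d t (v t.castSucc) (v t.succ) =
      MvPolynomial.monomial (PCM.mexp (edges 0 v) (edges 1 v)) 1 := by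
  rw [PCM.mexp, sum_edges, sum_edges, ← one_mul (1 : F), ← MvPolynomial.monomial_mul,
    MvPolynomial.monomial_sum_one, MvPolynomial.monomial_sum_one,
    ← Finset.prod_filter_mul_prod_filter_not Finset.univ (fun t : Fin d => t.val % 2 = 0)]
  congr 1
  · rw [Finset.prod_subtype (p := fun t : Fin d => t.val % 2 = 0) _ (by simp)]
    refine Finset.prod_congr rfl fun t _ => ?_
    rw [matB, dif_pos t.2]
    rfl
  · rw [Finset.prod_subtype (p := fun t : Fin d => t.val % 2 = 1) _ (by simp)]
    refine Finset.prod_congr rfl fun t _ => ?_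
    rw [matB, dif_neg (by rw [t.2]; exact one_ne_zero)]
    rfl

theorem pdMatrix_imm_apply {F : Type} [Field F] {n m : ℕ} (i j : Fin n)
    (p : Finset (OddV n (m + 1))) (q : Finset (EvenV n (m + 1))) :
    PCM.pdMatrix (imm F n (m + 1) i j) p q =
      ∑ u : Fin m → Fin n,
        if p = edges 0 (path i j u) ∧ q = edges 1 (path i j u) then 1 else 0 := by
  rw [PCM.pdMatrix, imm, prod_ofFn_apply, MvPolynomial.coeff_sum]
  refine Finset.sum_congr rfl fun u _ => ?_
  rw [prod_matB, MvPolynomial.coeff_monomial]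
  simp only [PCM.mexp_eq_mexp_iff, eq_comm]

theorem exists_edges_of_pdMatrix_imm_ne_zero {F : Type} [Field F] {n m : ℕ} {i j : Fin n}
    {p : Finset (OddV n (m + 1))} {q : Finset (EvenV n (m + 1))}
    (h : PCM.pdMatrix (imm F n (m + 1) i j) p q ≠ 0) :
    ∃ u : Fin m → Fin n, q = edges 1 (path i j u) := by
  rw [pdMatrix_imm_apply] at h
  obtain ⟨u, -, hu⟩ := Finset.exists_ne_zero_of_sum_ne_zero h
  exact ⟨u, (ite_ne_right_iff.1 hu).1.2⟩

end IMM

/-- for even `d = 2d'` and `f_{ij}` the `(i,j)` entry of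
`A^1 A^2 ⋯ A^d` under the partition `B`: (1) the partial derivatives matrix of
`f_{ij}^B` has rank exactly `n^{d-1}`; (2) for `j ≠ j'`, the sets of columns at which
the matrices of `f_{ij}^B` and `f_{ij'}^B` have a nonzero entry are disjoint. -/
theorem imm_entries_rank_and_disjoint_columns {F : Type} [Field F] (n d d' : ℕ)
    (hn : 0 < n) (hd' : 0 < d') (hd : d = 2 * d') :
    (∀ i j : Fin n, (PCM.pdMatrix (IMM.imm F n d i j)).rank = n ^ (d - 1)) ∧
    (∀ i : Fin n, ∀ j j' : Fin n, j ≠ j' →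
      ∀ q : Finset (IMM.EvenV n d),
        (∃ p, PCM.pdMatrix (IMM.imm F n d i j) p q ≠ 0) →
        ∀ p, PCM.pdMatrix (IMM.imm F n d i j') p q = 0) := by
  obtain ⟨m, rfl⟩ : ∃ m, d = m + 1 := ⟨d - 1, by omega⟩
  refine ⟨fun i j => ?_, fun i j j' hj q ⟨p, hp⟩ p' => ?_⟩
  · rw [Matrix.rank_eq_card_of_apply_eq_sum _ _ _ (IMM.edges_path_injective two_pos i j)
      (IMM.edges_path_injective one_lt_two i j) (IMM.pdMatrix_imm_apply i j)]
    simp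
  · by_contra hp'
    obtain ⟨u, hu⟩ := IMM.exists_edges_of_pdMatrix_imm_ne_zero hp
    obtain ⟨u', hu'⟩ := IMM.exists_edges_of_pdMatrix_imm_ne_zero hp'
    have hlast := (IMM.eq_of_edges_eq (hu.symm.trans hu') (Fin.last m)
      (by rw [Fin.val_last]; omega)).2
    rw [IMM.path_last, IMM.path_last] at hlast
    exact hj hlast
end
end
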